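/- arXiv:2106.05347 — 2 statements merged into one kernel-verified Lean document; each statement's English description precedes it below -/
import Mathlib

section
/- There exists a constant C > 0 such that for every integer n ≥ 5 there exists an (n,5,4)-system with independence number at most C · n^{log_3 2} (note log_3 2 < 0.631). -/
/-- `H` is an `(r,s)`-system (design) on vertex type `V`: every edge has `r` vertices and
every pair of distinct edges intersects in fewer than `s` vertices. -/
def IsDesign {V : Type*} [DecidableEq V] (r s : ℕ) (H : Finset (Finset V)) : Prop :=
  (∀ e ∈ H, e.card = r) ∧ ∀ e ∈ H, ∀ f ∈ H, e ≠ f → (e ∩ f).card < s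

/-- The independence number of `H` is at most `α`. -/
def IndepAtMost {V : Type*} (H : Finset (Finset V)) (α : ℝ) : Prop :=
  ∀ S : Finset V, (∀ e ∈ H, ¬ e ⊆ S) → (S.card : ℝ) ≤ α

open Finset in
/-- Number of 5-subsets of `S` meeting a fixed 5-set in at least 4 points. -/
lemma bad_card {V : Type*} [DecidableEq V] (S f : Finset V) (hf : f.card = 5) :
    ((S.powersetCard 5).filter (fun e => 4 ≤ (e ∩ f).card)).card ≤ 5 * S.card := by
  have hsub : (S.powersetCard 5).filter (fun e => 4 ≤ (e ∩ f).card) ⊆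
      ((f.powersetCard 4) ×ˢ S).image (fun p => insert p.2 p.1) := by
    intro e he
    rw [mem_filter, mem_powersetCard] at he
    obtain ⟨⟨heS, he5⟩, h4⟩ := he
    obtain ⟨g, hg, hg4⟩ := exists_subset_card_eq h4
    have hge : g ⊆ e := hg.trans inter_subset_left
    have hgf : g ⊆ f := hg.trans inter_subset_right
    have h1 : (e \ g).card = 1 := by
      rw [card_sdiff_of_subset hge]; omega
    obtain ⟨v, hv⟩ := card_eq_one.1 h1
    have hve : v ∈ e \ g := by rw [hv]; simp
    rw [mem_image]
    refine ⟨(g, v), ?_, ?_⟩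
    · rw [mem_product, mem_powersetCard]
      exact ⟨⟨hgf, hg4⟩, heS (mem_sdiff.1 hve).1⟩
    · have := sdiff_union_of_subset hge
      rw [hv] at this
      rw [← this]
      rfl
  refine (card_le_card hsub).trans (card_image_le.trans ?_)
  rw [card_product, card_powersetCard, hf]
  exact le_of_eq (by rfl)

open Finset in
/-- The 5-sets that may be added to `H`. -/
def avail {V : Type*} [DecidableEq V] (H : Finset (Finset V)) (S : Finset V) :
    Finset (Finset V) :=
  (S.powersetCard 5).filter (fun e => ∀ f ∈ H, (e ∩ f).card < 4)

open Finset in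
lemma mem_avail {V : Type*} [DecidableEq V] {H : Finset (Finset V)} {S e : Finset V} :
    e ∈ avail H S ↔ e ∈ S.powersetCard 5 ∧ ∀ f ∈ H, (e ∩ f).card < 4 := mem_filter

open Finset in
lemma avail_card {V : Type*} [DecidableEq V] (H : Finset (Finset V)) (S : Finset V)
    (hH : ∀ e ∈ H, e.card = 5) :
    S.card.choose 5 ≤ (avail H S).card + H.card * (5 * S.card) := by
  have hsub : S.powersetCard 5 ⊆ avail H S ∪
      H.biUnion (fun f => (S.powersetCard 5).filter (fun e => 4 ≤ (e ∩ f).card)) := by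
    intro e he
    by_cases h : ∀ f ∈ H, (e ∩ f).card < 4
    · exact mem_union_left _ (mem_filter.2 ⟨he, h⟩)
    · push Not at h
      obtain ⟨f, hf, h⟩ := h
      exact mem_union_right _ (mem_biUnion.2 ⟨f, hf, mem_filter.2 ⟨he, h⟩⟩)
  have h1 := card_le_card hsub
  rw [card_powersetCard] at h1
  refine h1.trans ((card_union_le _ _).trans ?_)
  gcongr
  exact card_biUnion_le_card_mul _ _ _ (fun f hf => bad_card S f (hH f hf))

open Finset in
/-- The `k`-sets containing no edge of `H`. -/
def unhit {V : Type*} [DecidableEq V] [Fintype V] (k : ℕ) (H : Finset (Finset V)) :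
    Finset (Finset V) :=
  (univ.powersetCard k).filter (fun S => ∀ e ∈ H, ¬ e ⊆ S)

open Finset in
lemma greedy_step (n k T : ℕ) (M : ℝ) (hn : 5 ≤ n) (hM0 : 0 ≤ M)
    (hM : M + T * (5 * k) ≤ (k.choose 5 : ℝ)) (H : Finset (Finset (Fin n)))
    (hH : IsDesign 5 4 H) (hT : H.card ≤ T) :
    ∃ H' : Finset (Finset (Fin n)), IsDesign 5 4 H' ∧ H'.card ≤ H.card + 1 ∧
      ((unhit k H').card : ℝ) ≤ (1 - M / (n : ℝ) ^ 5) * (unhit k H).card := by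
  have hav : ∀ S ∈ unhit k H, M ≤ ((avail H S).card : ℝ) := by
    intro S hS
    have hk : S.card = k := (mem_powersetCard.1 (mem_filter.1 hS).1).2
    have h := avail_card H S hH.1
    rw [hk] at h
    have h' : (k.choose 5 : ℝ) ≤ (avail H S).card + H.card * (5 * k) := by exact_mod_cast h
    have h2 : (H.card : ℝ) * (5 * k) ≤ T * (5 * k) := by gcongr
    linarith
  have hn0 : (0 : ℝ) < (n : ℝ) ^ 5 := by positivity
  -- double counting
  have hdc : ∑ S ∈ unhit k H, ((avail H S).card : ℝ) =
      ∑ e ∈ avail H univ, (((unhit k H).filter (fun S => e ⊆ S)).card : ℝ) := by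
    have : ∀ S ∈ unhit k H, avail H S = (avail H univ).filter (fun e => e ⊆ S) := by
      intro S _
      ext e
      simp only [avail, mem_filter, mem_powersetCard, subset_univ, true_and]
      tauto
    rw [sum_congr rfl (fun S hS => by rw [this S hS])]
    exact_mod_cast sum_card_bipartiteAbove_eq_sum_card_bipartiteBelow
      (s := unhit k H) (t := avail H univ) (fun S e => e ⊆ S)
  have hlow : M * (unhit k H).card ≤
      ∑ e ∈ avail H univ, (((unhit k H).filter (fun S => e ⊆ S)).card : ℝ) := by
    rw [← hdc]
    have := card_nsmul_le_sum (unhit k H) (fun S => ((avail H S).card : ℝ)) M hav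
    rw [nsmul_eq_mul] at this
    linarith
  have hcard : ((avail H (univ : Finset (Fin n))).card : ℝ) ≤ (n : ℝ) ^ 5 := by
    have : (avail H (univ : Finset (Fin n))).card ≤ n ^ 5 := by
      refine (card_le_card (fun e he => ?_ : _ ⊆ powersetCard 5 univ)).trans ?_
      · exact (mem_avail.1 he).1
      rw [card_powersetCard, card_univ, Fintype.card_fin]
      exact Nat.choose_le_pow n 5
    exact_mod_cast this
  set δ : ℝ := M / (n : ℝ) ^ 5 with hδ
  have hδ0 : 0 ≤ δ := by positivity
  by_cases hpos : M * (unhit k H).card ≤ 0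
  · refine ⟨H, hH, Nat.le_succ _, ?_⟩
    have : δ * (unhit k H).card ≤ 0 := by
      rw [hδ, div_mul_eq_mul_div]
      exact div_nonpos_of_nonpos_of_nonneg hpos hn0.le
    linarith
  push Not at hpos
  obtain ⟨e, he, hge⟩ : ∃ e ∈ avail H univ,
      δ * (unhit k H).card ≤ (((unhit k H).filter (fun S => e ⊆ S)).card : ℝ) := by
    by_contra hcon
    push Not at hcon
    have h1 := sum_le_card_nsmul (avail H univ)
      (fun e => (((unhit k H).filter (fun S => e ⊆ S)).card : ℝ)) _ (fun e he => (hcon e he).le)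
    have hne : (avail H (univ : Finset (Fin n))).Nonempty := by
      rw [nonempty_iff_ne_empty]
      intro h0
      rw [h0, sum_empty] at hlow
      linarith
    have h2 := sum_lt_sum_of_nonempty hne hcon
    rw [sum_const, nsmul_eq_mul] at h2
    have h3 : ((avail H (univ : Finset (Fin n))).card : ℝ) * (δ * (unhit k H).card) ≤
        (n : ℝ) ^ 5 * (δ * (unhit k H).card) := by gcongr
    have h4 : (n : ℝ) ^ 5 * (δ * (unhit k H).card) = M * (unhit k H).card := by
      rw [hδ]; field_simp
    linarith
  obtain ⟨he5, hef⟩ := mem_avail.1 he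
  have he5 := (mem_powersetCard.1 he5).2
  refine ⟨insert e H, ⟨?_, ?_⟩, card_insert_le _ _, ?_⟩
  · intro f hf
    rcases mem_insert.1 hf with rfl | hf
    · exact he5
    · exact hH.1 f hf
  · intro f hf g hg hfg
    rcases mem_insert.1 hf with hf1 | hf1 <;> rcases mem_insert.1 hg with hg1 | hg1
    · exact absurd (hf1.trans hg1.symm) hfg
    · rw [hf1]; exact hef g hg1
    · rw [inter_comm, hg1]; exact hef f hf1
    · exact hH.2 f hf1 g hg1 hfg
  · have heq : unhit k (insert e H) = (unhit k H).filter (fun S => ¬ e ⊆ S) := by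
      ext S
      simp only [unhit, mem_filter, mem_insert, forall_eq_or_imp]
      tauto
    have hsum := card_filter_add_card_filter_not (s := unhit k H) (fun S => e ⊆ S)
    have hsum' : (((unhit k H).filter (fun S => e ⊆ S)).card : ℝ) +
      ((unhit k H).filter (fun S => ¬ e ⊆ S)).card = (unhit k H).card := by exact_mod_cast hsum
    rw [heq]
    linarith

open Finset in
lemma greedy (n k T : ℕ) (M : ℝ) (hn : 5 ≤ n) (hM0 : 0 ≤ M) (hM1 : M ≤ (n : ℝ) ^ 5)
    (hM : M + T * (5 * k) ≤ (k.choose 5 : ℝ)) (t : ℕ) (ht : t ≤ T) :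
    ∃ H : Finset (Finset (Fin n)), IsDesign 5 4 H ∧ H.card ≤ t ∧
      ((unhit k H).card : ℝ) ≤ (1 - M / (n : ℝ) ^ 5) ^ t * (n : ℝ) ^ k := by
  induction t with
  | zero =>
    refine ⟨∅, ⟨by simp, by simp⟩, by simp, ?_⟩
    have : (unhit k (∅ : Finset (Finset (Fin n)))).card ≤ n ^ k := by
      first | unfold avail | unfold unhit
      refine (card_filter_le _ _).trans ?_
      rw [card_powersetCard, card_univ, Fintype.card_fin]
      exact Nat.choose_le_pow n k
    rw [pow_zero, one_mul]
    exact_mod_cast this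
  | succ t ih =>
    obtain ⟨H, hH, hc, hu⟩ := ih (by omega)
    obtain ⟨H', hH', hc', hu'⟩ := greedy_step n k T M hn hM0 hM H hH (by omega)
    refine ⟨H', hH', by omega, hu'.trans ?_⟩
    have h0 : 0 ≤ 1 - M / (n : ℝ) ^ 5 := by
      have : M / (n : ℝ) ^ 5 ≤ 1 := div_le_one_of_le₀ hM1 (by positivity)
      linarith
    calc _ ≤ (1 - M / (n : ℝ) ^ 5) * ((1 - M / (n : ℝ) ^ 5) ^ t * (n : ℝ) ^ k) := by gcongr
      _ = _ := by ring

open Finset in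
lemma exists_system (n k : ℕ) (hn : 5 ≤ n) (hk : 17 ≤ k) (hkn : k ≤ n)
    (hbig : 7680 ^ 2 * 10 * ((n : ℝ) ^ 5 * Real.log n) < (k : ℝ) ^ 8) :
    ∃ H : Finset (Finset (Fin n)), IsDesign 5 4 H ∧ unhit k H = ∅ := by
  have hk' : (17 : ℝ) ≤ k := by exact_mod_cast hk
  have hkn' : (k : ℝ) ≤ n := by exact_mod_cast hkn
  have hn' : (0 : ℝ) < n := by linarith
  set T : ℕ := ⌊(k : ℝ) ^ 4 / 38400⌋₊ with hT
  have hT1 : (T : ℝ) ≤ (k : ℝ) ^ 4 / 38400 := Nat.floor_le (by positivity)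
  have hT2 : (k : ℝ) ^ 4 / 38400 < T + 1 := Nat.lt_floor_add_one _
  have hk4 : (17 : ℝ) ^ 4 ≤ (k : ℝ) ^ 4 := by gcongr
  have hT3 : (k : ℝ) ^ 4 / 76800 ≤ T := by linarith
  have hch : (k : ℝ) ^ 5 / 3840 ≤ (k.choose 5 : ℝ) := by
    have h := Nat.pow_le_choose (α := ℝ) 5 k
    have e1 : ((k + 1 - 5 : ℕ) : ℝ) = k - 4 := by
      rw [Nat.cast_sub (by omega)]; push_cast; ring
    rw [e1] at h
    have h5 : (Nat.factorial 5 : ℝ) = 120 := by norm_num [Nat.factorial]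
    have h2 : ((k : ℝ) / 2) ^ 5 ≤ (k - 4) ^ 5 := by
      gcongr; linarith
    have h3 : (k : ℝ) ^ 5 / 32 ≤ 120 * (k.choose 5 : ℝ) := by
      rw [div_pow] at h2
      rw [← h5]
      norm_num at h2 h ⊢
      linarith
    linarith
  have hM : (k : ℝ) ^ 5 / 7680 + T * (5 * k) ≤ (k.choose 5 : ℝ) := by
    have : (T : ℝ) * (5 * k) ≤ (k : ℝ) ^ 4 / 38400 * (5 * k) := by gcongr
    have e : (k : ℝ) ^ 4 / 38400 * (5 * k) = (k : ℝ) ^ 5 / 7680 := by ring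
    linarith
  have hkn5 : (k : ℝ) ^ 5 ≤ (n : ℝ) ^ 5 := by gcongr
  have hM1 : (k : ℝ) ^ 5 / 7680 ≤ (n : ℝ) ^ 5 := by
    have : 0 ≤ (k : ℝ) ^ 5 := by positivity
    linarith
  obtain ⟨H, hH, -, hu⟩ := greedy n k T _ hn (by positivity) hM1 hM T le_rfl
  refine ⟨H, hH, ?_⟩
  rw [← card_eq_zero]
  have hlt : ((unhit k H).card : ℝ) < 1 := by
    refine hu.trans_lt ?_
    set δ : ℝ := (k : ℝ) ^ 5 / 7680 / (n : ℝ) ^ 5 with hδ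
    have hδ1 : δ ≤ 1 := div_le_one_of_le₀ hM1 (by positivity)
    have h1 : (1 - δ) ^ T ≤ Real.exp (-(δ * T)) := by
      calc (1 - δ) ^ T ≤ (Real.exp (-δ)) ^ T := by
            gcongr
            have := Real.add_one_le_exp (-δ); linarith
        _ = _ := by rw [← Real.exp_nat_mul]; congr 1; ring
    have h2 : (n : ℝ) ^ k = Real.exp (k * Real.log n) := by
      rw [Real.exp_nat_mul, Real.exp_log hn']
    have h3 : k * Real.log n < δ * T := by
      have : δ * ((k : ℝ) ^ 4 / 76800) ≤ δ * T := by gcongr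
      refine lt_of_lt_of_le ?_ this
      have e : δ * ((k : ℝ) ^ 4 / 76800) = k * ((k : ℝ) ^ 8 / (7680 ^ 2 * 10) / (n : ℝ) ^ 5) := by
        rw [hδ]; field_simp; norm_num
      rw [e]
      apply mul_lt_mul_of_pos_left _ (by linarith)
      rw [lt_div_iff₀ (by positivity), lt_div_iff₀ (by positivity)]
      linarith
    calc (1 - δ) ^ T * (n : ℝ) ^ k ≤ Real.exp (-(δ * T)) * Real.exp (k * Real.log n) := by
          rw [h2]; gcongr
      _ = Real.exp (-(δ * T) + k * Real.log n) := by rw [Real.exp_add]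
      _ < 1 := by rw [Real.exp_lt_one_iff]; linarith
  exact_mod_cast Nat.lt_one_iff.1 (by exact_mod_cast hlt)

theorem stmt2 :
    ∃ C : ℝ, 0 < C ∧ ∀ n : ℕ, 5 ≤ n →
      ∃ H : Finset (Finset (Fin n)),
        IsDesign 5 4 H ∧ IndepAtMost H (C * (n : ℝ) ^ (Real.log 2 / Real.log 3)) := by
  set θ : ℝ := Real.log 2 / Real.log 3 with hθ
  have hl3 : 0 < Real.log 3 := Real.log_pos (by norm_num)
  have hl2 : 0 < Real.log 2 := Real.log_pos (by norm_num)
  have hθ0 : 0 < θ := by positivity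
  have hε : 0 < 8 * θ - 5 := by
    have h : Real.log ((3 : ℝ) ^ 5) < Real.log ((2 : ℝ) ^ 8) :=
      Real.log_lt_log (by norm_num) (by norm_num)
    rw [Real.log_pow, Real.log_pow] at h
    push_cast at h
    have : 5 / 8 < θ := by
      rw [hθ, lt_div_iff₀ hl3]; linarith
    linarith
  set ε : ℝ := 8 * θ - 5 with hεd
  have hq : 0 < 7680 ^ 2 * 10 / ε := by positivity
  refine ⟨17 + 7680 ^ 2 * 10 / ε, by linarith, ?_⟩
  set C : ℝ := 17 + 7680 ^ 2 * 10 / ε with hC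
  intro n hn
  have hn' : (5 : ℝ) ≤ n := by exact_mod_cast hn
  have hnθ : 1 ≤ (n : ℝ) ^ θ := Real.one_le_rpow (by linarith) hθ0.le
  set k : ℕ := ⌈C * (n : ℝ) ^ θ⌉₊ with hk
  have hkC : C * (n : ℝ) ^ θ ≤ k := Nat.le_ceil _
  have hC17 : 17 ≤ C := by linarith
  by_cases hkn : k ≤ n
  · have hk17 : 17 ≤ k := by
      have : (17 : ℝ) ≤ k := by nlinarith
      exact_mod_cast this
    have hbig : 7680 ^ 2 * 10 * ((n : ℝ) ^ 5 * Real.log n) < (k : ℝ) ^ 8 := by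
      have h1 : Real.log n ≤ (n : ℝ) ^ ε / ε := Real.log_le_rpow_div (by linarith) hε
      have h2 : (n : ℝ) ^ 5 * (n : ℝ) ^ ε = ((n : ℝ) ^ θ) ^ 8 := by
        rw [← Real.rpow_natCast, ← Real.rpow_natCast, ← Real.rpow_add (by linarith),
          ← Real.rpow_mul (by linarith)]
        congr 1
        push_cast
        rw [hεd]; ring
      have h3 : C ≤ C ^ 8 := le_self_pow₀ (by linarith) (by norm_num)
      have h4 : 0 < ((n : ℝ) ^ θ) ^ 8 := by positivity
      calc 7680 ^ 2 * 10 * ((n : ℝ) ^ 5 * Real.log n)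
          ≤ 7680 ^ 2 * 10 * ((n : ℝ) ^ 5 * ((n : ℝ) ^ ε / ε)) := by gcongr
        _ = (7680 ^ 2 * 10 / ε) * ((n : ℝ) ^ 5 * (n : ℝ) ^ ε) := by ring
        _ = (7680 ^ 2 * 10 / ε) * ((n : ℝ) ^ θ) ^ 8 := by rw [h2]
        _ < C ^ 8 * ((n : ℝ) ^ θ) ^ 8 := by
            apply mul_lt_mul_of_pos_right _ h4
            linarith
        _ = (C * (n : ℝ) ^ θ) ^ 8 := by ring
        _ ≤ (k : ℝ) ^ 8 := by gcongr
    obtain ⟨H, hH, hu⟩ := exists_system n k hn hk17 hkn hbig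
    refine ⟨H, hH, ?_⟩
    intro S hS
    by_contra hcon
    push Not at hcon
    have hle : k ≤ S.card := Nat.ceil_le.2 hcon.le
    obtain ⟨S', hS', hc⟩ := Finset.exists_subset_card_eq hle
    have : S' ∈ unhit k H := by
      refine Finset.mem_filter.2 ⟨Finset.mem_powersetCard.2 ⟨Finset.subset_univ _, hc⟩, ?_⟩
      intro e he hsub
      exact hS e he (hsub.trans hS')
    rw [hu] at this
    simp at this
  · refine ⟨∅, ⟨by simp, by simp⟩, ?_⟩
    intro S _
    by_contra hcon
    push Not at hcon
    have hle : k ≤ S.card := Nat.ceil_le.2 hcon.le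
    have := Finset.card_le_univ S
    rw [Fintype.card_fin] at this
    omega
end

section
/- Let c = √2/(2−√3) and let k ≥ 1 be an integer. If there exists a (3^k, 5, 4)-system with independence number at most 7·2^k − c·3^{k/2}, then there exists a (3^{k+1}, 5, 4)-system with independence number at most 7·2^{k+1} − c·3^{(k+1)/2}. -/
/-- The crossing edge spanned by two vertices of part 0, two of part 1 and one of part 2. -/
def crossEdge {X : Type*} [DecidableEq X] (x x' y y' c : X) : Finset (X × Fin 3) :=
  {(x, 0), (x', 0), (y, 1), (y', 1), (c, 2)}

theorem crossEdge_card {X : Type*} [DecidableEq X] {x x' y y' c : X} (hx : x ≠ x') (hy : y ≠ y') :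
    (crossEdge x x' y y' c).card = 5 := by
  unfold crossEdge
  rw [Finset.card_insert_of_notMem, Finset.card_insert_of_notMem, Finset.card_insert_of_notMem,
    Finset.card_insert_of_notMem, Finset.card_singleton] <;> simp [hx, hy]

theorem cross_inter {X F : Type*} [DecidableEq X] [Field F] [CharP F 2] (φ : X → F)
    (hφ : Function.Injective φ) (h0 : ∀ x, φ x ≠ 0)
    {x x' y y' c u u' v v' d : X} (hx : x ≠ x') (hy : y ≠ y') (hu : u ≠ u') (hv : v ≠ v')
    (he : φ x + φ x' = φ c * (φ y + φ y')) (hf : φ u + φ u' = φ d * (φ v + φ v'))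
    (hne : crossEdge x x' y y' c ≠ crossEdge u u' v v' d) :
    (crossEdge x x' y y' c ∩ crossEdge u u' v v' d).card < 4 := by
  by_contra hlt
  have h5 := crossEdge_card (c := c) hx hy
  have h5' := crossEdge_card (c := d) hu hv
  have hsd := Finset.card_sdiff_add_card_inter (crossEdge x x' y y' c) (crossEdge u u' v v' d)
  have hle : (crossEdge x x' y y' c \ crossEdge u u' v v' d).card ≤ 1 := by omega
  rw [Finset.card_le_one] at hle
  have key : ∀ a ∈ crossEdge x x' y y' c, ∀ b ∈ crossEdge x x' y y' c, a ≠ b →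
      a ∉ crossEdge u u' v v' d → b ∈ crossEdge u u' v v' d := by
    intro a ha b hb hab ha'
    by_contra hb'
    exact hab (hle a (by simp [ha, ha']) b (by simp [hb, hb']))
  have hsub : ¬ crossEdge x x' y y' c ⊆ crossEdge u u' v v' d := fun h =>
    hne (Finset.eq_of_subset_of_card_le h (by omega))
  have memf0 : ∀ z, (z, (0 : Fin 3)) ∈ crossEdge u u' v v' d ↔ z = u ∨ z = u' := by
    intro z; simp [crossEdge]
  have memf1 : ∀ z, (z, (1 : Fin 3)) ∈ crossEdge u u' v v' d ↔ z = v ∨ z = v' := by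
    intro z; simp [crossEdge]
  have memf2 : ∀ z, (z, (2 : Fin 3)) ∈ crossEdge u u' v v' d ↔ z = d := by
    intro z; simp [crossEdge]
  have pair : ∀ {a b p q : X}, a ≠ b → (a = p ∨ a = q) → (b = p ∨ b = q) →
      φ a + φ b = φ p + φ q := by
    rintro a b p q hab (rfl | rfl) (rfl | rfl)
    · exact absurd rfl hab
    · rfl
    · exact add_comm _ _
    · exact absurd rfl hab
  have solve : ∀ {a b p q : X}, φ a + φ b = φ p + φ q → (b = p ∨ b = q) → (a = p ∨ a = q) := by
    rintro a b p q hab (rfl | rfl)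
    · right; apply hφ; rw [add_comm (φ b)] at hab; exact add_right_cancel hab
    · left; apply hφ; exact add_right_cancel hab
  have m1 : (x, (0 : Fin 3)) ∈ crossEdge x x' y y' c := by simp [crossEdge]
  have m2 : (x', (0 : Fin 3)) ∈ crossEdge x x' y y' c := by simp [crossEdge]
  have m3 : (y, (1 : Fin 3)) ∈ crossEdge x x' y y' c := by simp [crossEdge]
  have m4 : (y', (1 : Fin 3)) ∈ crossEdge x x' y y' c := by simp [crossEdge]
  have m5 : (c, (2 : Fin 3)) ∈ crossEdge x x' y y' c := by simp [crossEdge]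
  rw [Finset.not_subset] at hsub
  obtain ⟨a, ha, haf⟩ := hsub
  have k1 := fun h => key a ha _ m1 h haf
  have k2 := fun h => key a ha _ m2 h haf
  have k3 := fun h => key a ha _ m3 h haf
  have k4 := fun h => key a ha _ m4 h haf
  have k5 := fun h => key a ha _ m5 h haf
  rw [memf0] at k1 k2
  rw [memf1] at k3 k4
  rw [memf2] at k5
  have ha2 : a = (x, 0) ∨ a = (x', 0) ∨ a = (y, 1) ∨ a = (y', 1) ∨ a = (c, 2) := by
    simpa [crossEdge] using ha
  rcases ha2 with rfl | rfl | rfl | rfl | rfl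
  · rw [memf0] at haf
    have e2 := k2 (by simp [hx])
    have e3 := k3 (by simp)
    have e4 := k4 (by simp)
    have e5 := k5 (by simp)
    refine haf (solve ?_ e2)
    rw [he, hf, pair hy e3 e4, e5]
  · rw [memf0] at haf
    have e2 := k1 (by simp [hx.symm])
    have e3 := k3 (by simp)
    have e4 := k4 (by simp)
    have e5 := k5 (by simp)
    refine haf (solve ?_ e2)
    rw [add_comm, he, hf, pair hy e3 e4, e5]
  · rw [memf1] at haf
    have e1 := k1 (by simp)
    have e2 := k2 (by simp)
    have e4 := k4 (by simp [hy])
    have e5 := k5 (by simp)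
    refine haf (solve ?_ e4)
    apply mul_left_cancel₀ (h0 c)
    rw [← he, pair hx e1 e2, hf, e5]
  · rw [memf1] at haf
    have e1 := k1 (by simp)
    have e2 := k2 (by simp)
    have e4 := k3 (by simp [hy.symm])
    have e5 := k5 (by simp)
    refine haf (solve ?_ e4)
    apply mul_left_cancel₀ (h0 c)
    rw [add_comm, ← he, pair hx e1 e2, hf, e5]
  · rw [memf2] at haf
    have e1 := k1 (by simp)
    have e2 := k2 (by simp)
    have e3 := k3 (by simp)
    have e4 := k4 (by simp)
    apply haf
    apply hφ
    have hyy : φ y + φ y' ≠ 0 := by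
      intro h
      exact hy (hφ (CharTwo.add_eq_zero.1 h))
    apply mul_right_cancel₀ hyy
    rw [← he, pair hx e1 e2, hf, pair hy e3 e4]

/-- The tripling construction. -/
theorem triple_construct {X F : Type*} [DecidableEq X] [Fintype X] [Field F] [CharP F 2]
    [Fintype F] (φ : X → F)
    (hφ : Function.Injective φ) (h0 : ∀ x, φ x ≠ 0) (hcard : Fintype.card F ≤ 2 * Fintype.card X)
    (H : Finset (Finset X)) (hH : IsDesign 5 4 H) (α : ℝ) (hα : IndepAtMost H α) :
    ∃ G : Finset (Finset (X × Fin 3)), IsDesign 5 4 G ∧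
      IndepAtMost G (2 * α + Real.sqrt (2 * Fintype.card X)) := by
  classical
  have inj : ∀ i : Fin 3, Function.Injective (fun x : X => (x, i)) := by
    intro i a b h; simpa using h
  let G : Finset (Finset (X × Fin 3)) := Finset.univ.filter (fun e =>
    (∃ i : Fin 3, ∃ h ∈ H, e = h.image (fun x => (x, i))) ∨
    (∃ x x' y y' c, x ≠ x' ∧ y ≠ y' ∧ φ x + φ x' = φ c * (φ y + φ y') ∧
      e = crossEdge x x' y y' c))
  have memG : ∀ e, e ∈ G ↔ (∃ i : Fin 3, ∃ h ∈ H, e = h.image (fun x => (x, i))) ∨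
    (∃ x x' y y' c, x ≠ x' ∧ y ≠ y' ∧ φ x + φ x' = φ c * (φ y + φ y') ∧
      e = crossEdge x x' y y' c) := by intro e; simp [G]
  have mixed : ∀ (i : Fin 3) (h : Finset X) (x x' y y' c : X),
      (h.image (fun x => (x, i)) ∩ crossEdge x x' y y' c).card < 4 := by
    intro i h x x' y y' c
    have hs : h.image (fun x => (x, i)) ∩ crossEdge x x' y y' c ⊆
        (if i = 0 then {(x, 0), (x', 0)} else if i = 1 then {(y, 1), (y', 1)} else {(c, 2)}) := by
      intro p hp
      rw [Finset.mem_inter, Finset.mem_image] at hp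
      obtain ⟨⟨z, _, rfl⟩, hp⟩ := hp
      fin_cases i <;> simpa [crossEdge] using hp
    refine lt_of_le_of_lt (Finset.card_le_card hs) ?_
    split_ifs
    · exact lt_of_le_of_lt Finset.card_le_two (by norm_num)
    · exact lt_of_le_of_lt Finset.card_le_two (by norm_num)
    · simp
  refine ⟨G, ⟨?_, ?_⟩, ?_⟩
  · intro e he
    rcases (memG e).1 he with ⟨i, h, hh, rfl⟩ | ⟨x, x', y, y', c, hx, hy, _, rfl⟩
    · rw [Finset.card_image_of_injective _ (inj i)]; exact hH.1 h hh
    · exact crossEdge_card hx hy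
  · intro e he f hf hne
    rcases (memG e).1 he with ⟨i, h, hh, rfl⟩ | ⟨x, x', y, y', c, hx, hy, hxy, rfl⟩ <;>
    rcases (memG f).1 hf with ⟨j, g, hg, rfl⟩ | ⟨u, u', v, v', d, hu, hv, huv, rfl⟩
    · by_cases hij : i = j
      · subst hij
        rw [← Finset.image_inter _ _ (inj i), Finset.card_image_of_injective _ (inj i)]
        exact hH.2 h hh g hg (fun hc => hne (by rw [hc]))
      · have : h.image (fun x => (x, i)) ∩ g.image (fun x => (x, j)) = ∅ := by
          rw [← Finset.disjoint_iff_inter_eq_empty, Finset.disjoint_left]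
          intro p hp hq
          rw [Finset.mem_image] at hp hq
          obtain ⟨a, _, rfl⟩ := hp
          obtain ⟨b, _, hb⟩ := hq
          exact hij (Prod.ext_iff.1 hb).2.symm
        rw [this]; simp
    · exact mixed _ _ _ _ _ _ _
    · rw [Finset.inter_comm]; exact mixed _ _ _ _ _ _ _
    · exact cross_inter φ hφ h0 hx hy hu hv hxy huv hne
  · intro S hS
    let T : Fin 3 → Finset X := fun i => Finset.univ.filter (fun x => (x, i) ∈ S)
    have memT : ∀ i x, x ∈ T i ↔ (x, i) ∈ S := by intro i x; simp [T]
    have hTα : ∀ i, ((T i).card : ℝ) ≤ α := by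
      intro i
      apply hα
      intro e he hsub
      refine hS _ ((memG _).2 (Or.inl ⟨i, e, he, rfl⟩)) ?_
      intro p hp
      obtain ⟨z, hz, rfl⟩ := Finset.mem_image.1 hp
      exact (memT _ _).1 (hsub hz)
    have hcardS : S.card = (T 0).card + (T 1).card + (T 2).card := by
      have := Finset.card_eq_sum_card_fiberwise (f := Prod.snd) (s := S) (t := Finset.univ)
        (by intro p _; simp)
      rw [this, Fin.sum_univ_three]
      have hc : ∀ i : Fin 3, (S.filter (fun p => p.2 = i)).card = (T i).card := by
        intro i
        rw [← Finset.card_image_of_injective (T i) (inj i)]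
        congr 1
        ext ⟨a, b⟩
        simp only [Finset.mem_filter, Finset.mem_image, memT, Prod.mk.injEq]
        constructor
        · rintro ⟨h, rfl⟩; exact ⟨a, h, rfl, rfl⟩
        · rintro ⟨z, h, rfl, rfl⟩; exact ⟨h, rfl⟩
      rw [hc, hc, hc]
    have hsq := Real.sqrt_nonneg (2 * (Fintype.card X : ℝ))
    rw [hcardS]
    push_cast
    have t0 := hTα 0
    have t1 := hTα 1
    have t2 := hTα 2
    rcases (T 2).eq_empty_or_nonempty with hemp | ⟨c, hc⟩
    · rw [hemp]; simp only [Finset.card_empty, Nat.cast_zero]; linarith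
    have hprod : (T 0).card * (T 1).card ≤ 2 * Fintype.card X := by
      by_contra hgt
      have hlt : (Finset.univ : Finset F).card < (T 0 ×ˢ T 1).card := by
        rw [Finset.card_product, Finset.card_univ]; omega
      obtain ⟨⟨x, y⟩, hp, ⟨x', y'⟩, hq, hpq, heq⟩ :=
        Finset.exists_ne_map_eq_of_card_lt_of_maps_to hlt
          (f := fun p : X × X => φ p.1 + φ c * φ p.2) (by intro p _; simp)
      simp only at heq
      rw [Finset.mem_product] at hp hq
      have hx : x ≠ x' := by
        rintro rfl
        apply hpq
        have := hφ (mul_left_cancel₀ (h0 c) (add_left_cancel heq))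
        rw [this]
      have hy : y ≠ y' := by
        rintro rfl
        apply hpq
        rw [hφ (add_right_cancel heq)]
      have hE : φ x + φ x' = φ c * (φ y + φ y') := by
        have h2 : (2 : F) = 0 := CharTwo.two_eq_zero
        linear_combination heq + (φ x' - φ c * φ y) * h2
      refine hS _ ((memG _).2 (Or.inr ⟨x, x', y, y', c, hx, hy, hE, rfl⟩)) ?_
      have a1 := (memT _ _).1 hp.1
      have a2 := (memT _ _).1 hp.2
      have a3 := (memT _ _).1 hq.1
      have a4 := (memT _ _).1 hq.2
      have a5 := (memT _ _).1 hc
      intro p hp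
      simp only [crossEdge, Finset.mem_insert, Finset.mem_singleton] at hp
      rcases hp with rfl | rfl | rfl | rfl | rfl <;> assumption
    have hprod' : ((T 0).card : ℝ) * (T 1).card ≤ 2 * Fintype.card X := by exact_mod_cast hprod
    rcases le_total ((T 0).card : ℝ) (T 1).card with h | h
    · have : ((T 0).card : ℝ) ≤ Real.sqrt (2 * Fintype.card X) := by
        apply Real.le_sqrt_of_sq_le
        nlinarith [Nat.cast_nonneg (α := ℝ) (T 0).card]
      linarith
    · have : ((T 1).card : ℝ) ≤ Real.sqrt (2 * Fintype.card X) := by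
        apply Real.le_sqrt_of_sq_le
        nlinarith [Nat.cast_nonneg (α := ℝ) (T 1).card]
      linarith

theorem design_transport {V W : Type*} [DecidableEq V] [DecidableEq W] (e : V ≃ W)
    (G : Finset (Finset V)) (α : ℝ) (hG : IsDesign 5 4 G) (hα : IndepAtMost G α) :
    ∃ G' : Finset (Finset W), IsDesign 5 4 G' ∧ IndepAtMost G' α := by
  refine ⟨G.image (fun s => s.map e.toEmbedding), ⟨?_, ?_⟩, ?_⟩
  · intro s hs
    obtain ⟨t, ht, rfl⟩ := Finset.mem_image.1 hs
    rw [Finset.card_map]; exact hG.1 t ht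
  · intro s hs s' hs' hne
    obtain ⟨t, ht, rfl⟩ := Finset.mem_image.1 hs
    obtain ⟨t', ht', rfl⟩ := Finset.mem_image.1 hs'
    rw [← Finset.map_inter, Finset.card_map]
    exact hG.2 t ht t' ht' (fun h => hne (by rw [h]))
  · intro S hS
    have := hα (S.map e.symm.toEmbedding) (by
      intro t ht hsub
      refine hS _ (Finset.mem_image.2 ⟨t, ht, rfl⟩) ?_
      intro w hw
      obtain ⟨v, hv, rfl⟩ := Finset.mem_map.1 hw
      obtain ⟨w, hw, h⟩ := Finset.mem_map.1 (hsub hv)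
      rw [← h]; simpa using hw)
    rwa [Finset.card_map] at this

theorem stmt13 (k : ℕ) (hk : 1 ≤ k)
    (hex : ∃ H : Finset (Finset (Fin (3 ^ k))), IsDesign 5 4 H ∧
      IndepAtMost H (7 * 2 ^ k - Real.sqrt 2 / (2 - Real.sqrt 3) * (3 : ℝ) ^ ((k : ℝ) / 2))) :
    ∃ H : Finset (Finset (Fin (3 ^ (k + 1)))), IsDesign 5 4 H ∧
      IndepAtMost H (7 * 2 ^ (k + 1) -
        Real.sqrt 2 / (2 - Real.sqrt 3) * (3 : ℝ) ^ (((k : ℝ) + 1) / 2)) := by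
  classical
  obtain ⟨H, hH, hα⟩ := hex
  have hpos : 0 < 3 ^ k := by positivity
  set j := Nat.log 2 (3 ^ k) + 1 with hj
  haveI : Fintype (GaloisField 2 j) := Fintype.ofFinite _
  have hF : Fintype.card (GaloisField 2 j) = 2 ^ j := by
    rw [← Nat.card_eq_fintype_card]; exact GaloisField.card 2 j (by omega)
  have hlt : 3 ^ k < 2 ^ j := Nat.lt_pow_succ_log_self (by norm_num) _
  have hle : 2 ^ j ≤ 2 * 3 ^ k := by
    rw [hj, pow_succ, mul_comm]
    exact Nat.mul_le_mul_left _ (Nat.pow_log_le_self 2 hpos.ne')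
  have hunits : Fintype.card (Fin (3 ^ k)) ≤ Fintype.card (GaloisField 2 j)ˣ := by
    rw [Fintype.card_units, hF, Fintype.card_fin]; omega
  obtain ⟨ι⟩ := Function.Embedding.nonempty_of_card_le hunits
  obtain ⟨G, hG, hGα⟩ := triple_construct (fun x => (ι x : GaloisField 2 j))
    (fun a b h => ι.injective (Units.ext h)) (fun x => (ι x).ne_zero)
    (by rw [hF, Fintype.card_fin]; exact hle) H hH _ hα
  have e : Fin (3 ^ k) × Fin 3 ≃ Fin (3 ^ (k + 1)) :=
    Fintype.equivOfCardEq (by simp [pow_succ])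
  obtain ⟨G', hG', hGα'⟩ := design_transport e G _ hG hGα
  refine ⟨G', hG', ?_⟩
  convert hGα' using 1
  rw [Fintype.card_fin]
  push_cast
  have h3 : (3 : ℝ) ^ (((k : ℝ) + 1) / 2) = (3 : ℝ) ^ ((k : ℝ) / 2) * Real.sqrt 3 := by
    rw [Real.sqrt_eq_rpow, ← Real.rpow_add (by norm_num)]; congr 1; ring
  have hs : Real.sqrt (2 * 3 ^ k) = Real.sqrt 2 * (3 : ℝ) ^ ((k : ℝ) / 2) := by
    rw [Real.sqrt_mul (by norm_num), Real.sqrt_eq_rpow (3 ^ k), ← Real.rpow_natCast,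
      ← Real.rpow_mul (by norm_num)]
    congr 2; ring
  have hne : 2 - Real.sqrt 3 ≠ 0 := by
    have : Real.sqrt 3 < 2 := by
      rw [Real.sqrt_lt' (by norm_num)]; norm_num
    linarith
  rw [h3, hs]
  field_simp
  ring
end
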